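/- arXiv:math/9806075 — 3 statements merged into one kernel-verified Lean document; each statement's English description precedes it below -/
import Mathlib

section
/- Let K be an odd prime, ζ = exp(2πi/K), and let p, m ∈ ℤ with p not divisible by K. Let 4*, p* ∈ ℤ satisfy 4·4* ≡ 1 (mod K) and p·p* ≡ 1 (mod K), and let κ = 1 if K ≡ 1 (mod 4), κ = −1 if K ≡ 3 (mod 4). Then the sum over all odd integers β with −K < β ≤ K satisfies: Σ_{β odd, −K<β≤K} ζ^{4*·p·β² + m·β} = (|p|/K) · e^{(iπ/4)(1−κ)·sign(p)} · √K · ζ^{−m²·p*}, where (|p|/K) is the Legendre symbol of |p| modulo K. -/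
open Polynomial

noncomputable def gsTheta (F : Type*) [Field F] : Module.End F F[X] :=
  (LinearMap.mulLeft F (X : F[X])) ∘ₗ (derivative : F[X] →ₗ[F] F[X])

lemma gsTheta_apply {F : Type*} [Field F] (f : F[X]) : gsTheta F f = X * derivative f := rfl

lemma gsTheta_pow_sub {F : Type*} [Field F] (m : ℕ) : ∀ q : F[X],
    ((gsTheta F ^ m) ((X - 1) ^ m * q)).eval 1 = (m.factorial : F) * q.eval 1 := by
  induction m with
  | zero => intro q; simp
  | succ m ih =>
    intro q
    have h : gsTheta F ((X - 1) ^ (m + 1) * q)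
        = (X - 1) ^ m * (((m : F[X]) + 1) * X * q + (X - 1) * X * derivative q) := by
      rw [gsTheta_apply, derivative_mul, derivative_pow]
      simp
      ring
    rw [pow_succ, Module.End.mul_apply, h, ih]
    simp [Nat.factorial_succ]
    ring

lemma gsTheta_pow_X {F : Type*} [Field F] (m a : ℕ) :
    (gsTheta F ^ m) (X ^ a) = C ((a : F) ^ m) * X ^ a := by
  induction m with
  | zero => simp
  | succ m ih =>
    rw [pow_succ', Module.End.mul_apply, ih, gsTheta_apply]
    rcases a with _ | a
    · rcases m with _ | m <;> simp
    · simp [derivative_pow]; ring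

lemma gs_factor {F : Type*} [Field F] (a b : ℕ) :
    ∃ h : F[X], X ^ a - X ^ b = (X - 1) * h ∧ h.eval 1 = (a : F) - b := by
  refine ⟨∑ i ∈ Finset.range a, X ^ i - ∑ i ∈ Finset.range b, X ^ i, ?_, ?_⟩
  · rw [mul_sub, mul_geom_sum, mul_geom_sum]; ring
  · simp [eval_finsetSum]

lemma gs_eps (n : ℕ) [Fact (2 * n + 1).Prime] (hn : 0 < n) (e : ZMod (2 * n + 1))
    (q : (ZMod (2 * n + 1))[X])
    (h : ∑ x : ZMod (2 * n + 1), (X : (ZMod (2 * n + 1))[X]) ^ (x ^ 2).val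
      - C e * ∏ k ∈ Finset.range n, (X ^ ((2 * n - k) * (n + 1)) - X ^ ((k + 1) * (n + 1)))
      = (X - 1) ^ (2 * n) * q) : e = 1 := by
  choose H hH hH1 using fun a b : ℕ => gs_factor (F := ZMod (2 * n + 1)) a b
  simp_rw [hH, Finset.prod_mul_distrib, Finset.prod_const, Finset.card_range] at h
  have hK : (2 * (n : ZMod (2 * n + 1)) + 1) = 0 := by
    have := ZMod.natCast_self (2 * n + 1)
    push_cast at this; exact this
  have hpow : (X - 1) ^ (2 * n) * q = (X - 1) ^ n * ((X - 1) ^ n * q) := by ring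
  have h1 := congrArg (fun f => ((gsTheta _ ^ n) f).eval 1) h
  simp only [map_sub, map_sum, gsTheta_pow_X, eval_sub, eval_finsetSum] at h1
  rw [mul_left_comm, gsTheta_pow_sub, hpow, gsTheta_pow_sub] at h1
  simp only [eval_mul, eval_C, eval_pow, eval_X, one_pow, mul_one, eval_prod, eval_sub, eval_one,
    sub_self, zero_pow hn.ne', zero_mul, mul_zero, hH1, ZMod.natCast_val, ZMod.cast_id', id] at h1
  have h2 : ∑ x : ZMod (2 * n + 1), (x ^ 2) ^ n = -1 := by
    have : ∀ x : ZMod (2 * n + 1), (x ^ 2) ^ n = 1 - if x = 0 then 1 else 0 := by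
      intro x
      split_ifs with hx
      · simp [hx, hn.ne']
      · rw [← pow_mul, sub_zero]; exact ZMod.pow_card_sub_one_eq_one hx
    simp [this]
  have h3 : (n.factorial : ZMod (2 * n + 1)) * ∏ k ∈ Finset.range n,
      ((((2 * n - k) * (n + 1) : ℕ) : ZMod (2 * n + 1)) - ((k + 1) * (n + 1) : ℕ)) = -1 := by
    have : ∀ k ∈ Finset.range n,
      ((((2 * n - k) * (n + 1) : ℕ) : ZMod (2 * n + 1)) - ((k + 1) * (n + 1) : ℕ))
        = ((2 * n - k : ℕ) : ZMod (2 * n + 1)) := by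
      intro k hk
      have hk := Finset.mem_range.1 hk
      push_cast [Nat.cast_sub (show k ≤ 2 * n by omega)]
      linear_combination ((n : ZMod (2 * n + 1)) - k - 1) * hK
    rw [Finset.prod_congr rfl this, ← Nat.cast_prod, ← Nat.descFactorial_eq_prod_range,
      ← Nat.cast_mul]
    have h4 := Nat.factorial_mul_descFactorial (show n ≤ 2 * n by omega)
    rw [show 2 * n - n = n by omega] at h4
    rw [h4]
    exact ZMod.wilsons_lemma (2 * n + 1)
  simp only [h2] at h1
  linear_combination h1 + e * h3

lemma gs_sin_prod (n : ℕ) :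
    ∏ k ∈ Finset.range n, (2 * Real.sin (Real.pi * (k + 1) / (2 * n + 1)))
      = Real.sqrt (2 * n + 1) := by
  have hpos : ∀ k : ℕ, k < 2 * n → 0 < Real.sin (Real.pi * (k + 1) / (2 * n + 1)) := by
    intro k hk
    have hk' : (k : ℝ) < 2 * n := by exact_mod_cast hk
    apply Real.sin_pos_of_pos_of_lt_pi
    · have := Real.pi_pos; positivity
    · rw [div_lt_iff₀ (by positivity)]
      have := Real.pi_pos
      nlinarith
  have hprim := Complex.isPrimitiveRoot_exp (2 * n + 1) (by omega)
  have h := congrArg norm hprim.prod_one_sub_pow_eq_order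
  rw [norm_prod] at h
  have hterm : ∀ k ∈ Finset.range (2 * n),
      ‖1 - Complex.exp (2 * Real.pi * Complex.I / ((2 * n + 1 : ℕ) : ℂ)) ^ (k + 1)‖
        = 2 * Real.sin (Real.pi * (k + 1) / (2 * n + 1)) := by
    intro k hk
    rw [norm_sub_rev, ← Complex.exp_nat_mul]
    have := Complex.norm_exp_I_mul_ofReal_sub_one (2 * (Real.pi * (k + 1) / (2 * n + 1)))
    rw [mul_div_cancel_left₀ _ (two_ne_zero), Real.norm_of_nonneg
      (by have := hpos k (Finset.mem_range.1 hk); positivity)] at this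
    rw [← this]
    congr 3
    push_cast
    ring
  rw [Finset.prod_congr rfl hterm, two_mul, Finset.prod_range_add,
    ← Finset.prod_range_reflect (fun x => 2 * Real.sin (Real.pi * (((n + x : ℕ) : ℝ) + 1) / (2 * n + 1)))] at h
  have h2 : ∀ k ∈ Finset.range n,
      2 * Real.sin (Real.pi * (((n + (n - 1 - k) : ℕ) : ℝ) + 1) / (2 * n + 1))
        = 2 * Real.sin (Real.pi * (k + 1) / (2 * n + 1)) := by
    intro k hk
    have hk := Finset.mem_range.1 hk
    rw [← Real.sin_pi_sub]
    congr 2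
    have : ((n + (n - 1 - k) : ℕ) : ℝ) = 2 * n - 1 - k := by
      rw [show n + (n - 1 - k) = 2 * n - (1 + k) by omega, Nat.cast_sub (by omega)]
      push_cast; ring
    rw [this]
    field_simp
    ring
  rw [Finset.prod_congr rfl h2] at h
  symm
  rw [Real.sqrt_eq_iff_mul_self_eq (by positivity)]
  · rw [h]
    have e : (((n + n : ℕ) : ℂ) + 1) = ((2 * n + 1 : ℝ) : ℂ) := by push_cast; ring
    rw [e, Complex.norm_real, Real.norm_of_nonneg (by positivity)]
  · apply Finset.prod_nonneg
    intro k hk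
    have := hpos k (by have := Finset.mem_range.1 hk; omega)
    positivity

lemma gs_sign (n : ℕ) : (∏ k ∈ Finset.range n, (-1 : ℂ) ^ k) * Complex.I ^ n
    = if Even n then 1 else Complex.I := by
  induction n using Nat.twoStepInduction with
  | zero => simp
  | one => simp
  | more n ih _ =>
    rw [Finset.prod_range_succ, Finset.prod_range_succ]
    have : Even (n + 2) ↔ Even n := by simp [Nat.even_add]
    simp only [this]
    rw [← ih]
    have h1 : ((-1 : ℂ) ^ n) * (-1) ^ n = 1 := by rw [← mul_pow]; simp
    rw [pow_succ (-1 : ℂ) n, pow_add, Complex.I_sq]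
    linear_combination (∏ k ∈ Finset.range n, (-1 : ℂ) ^ k) * Complex.I ^ n * h1

lemma gs_prod (n : ℕ) (ζ : ℂ) (hζ : ζ = Complex.exp (2 * Real.pi * Complex.I / (2 * n + 1 : ℕ))) :
    ∏ k ∈ Finset.range n, (ζ ^ ((2 * n - k) * (n + 1)) - ζ ^ ((k + 1) * (n + 1)))
      = (if Even n then 1 else Complex.I) * (Real.sqrt (2 * n + 1) : ℂ) := by
  have hK : (2 * (n : ℂ) + 1) ≠ 0 := by exact_mod_cast (Nat.succ_ne_zero (2 * n))
  have hw : ζ ^ (n + 1) = - Complex.exp (Real.pi * Complex.I / (2 * n + 1)) := by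
    rw [hζ, ← Complex.exp_nat_mul, ← neg_one_mul, ← Complex.exp_pi_mul_I, ← Complex.exp_add]
    congr 1
    push_cast
    linear_combination Real.pi * Complex.I * mul_inv_cancel₀ hK
  have hζK : ζ ^ (2 * n + 1) = 1 := by
    rw [hζ]; exact (Complex.isPrimitiveRoot_exp (2 * n + 1) (by omega)).pow_eq_one
  have hterm : ∀ k ∈ Finset.range n, (ζ ^ ((2 * n - k) * (n + 1)) - ζ ^ ((k + 1) * (n + 1)))
      = (-1) ^ k * Complex.I * ((2 * Real.sin (Real.pi * (k + 1) / (2 * n + 1)) : ℝ) : ℂ) := by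
    intro k hk
    have hk := Finset.mem_range.1 hk
    have e1 : ζ ^ ((k + 1) * (n + 1))
        = (-1) ^ (k + 1) * Complex.exp ((Real.pi * (k + 1) / (2 * n + 1)) * Complex.I) := by
      rw [mul_comm, pow_mul, hw, neg_pow, ← Complex.exp_nat_mul]
      congr 2
      push_cast; ring
    have e2 : ζ ^ ((2 * n - k) * (n + 1))
        = (-1) ^ (k + 1) * Complex.exp (-(Real.pi * (k + 1) / (2 * n + 1)) * Complex.I) := by
      have h1 : ζ ^ ((2 * n - k) * (n + 1)) * ζ ^ ((k + 1) * (n + 1)) = 1 := by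
        rw [← pow_add, ← add_mul, show 2 * n - k + (k + 1) = 2 * n + 1 by omega, pow_mul, hζK,
          one_pow]
      have h2 : ((-1) ^ (k + 1) * Complex.exp (-(Real.pi * (k + 1) / (2 * n + 1)) * Complex.I))
          * ζ ^ ((k + 1) * (n + 1)) = 1 := by
        rw [e1, mul_mul_mul_comm, ← mul_pow, ← Complex.exp_add]
        simp
      have h3 : ζ ^ ((k + 1) * (n + 1)) ≠ 0 := right_ne_zero_of_mul_eq_one h1
      exact mul_right_cancel₀ h3 (h1.trans h2.symm)
    rw [e1, e2]
    push_cast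
    rw [Complex.sin, pow_succ]
    linear_combination (-1 : ℂ) ^ k * (Complex.exp (-(Real.pi * (k + 1) / (2 * n + 1)) * Complex.I)
      - Complex.exp ((Real.pi * (k + 1) / (2 * n + 1)) * Complex.I)) * (-Complex.I_sq)
  rw [Finset.prod_congr rfl hterm, Finset.prod_mul_distrib, Finset.prod_mul_distrib,
    Finset.prod_const, Finset.card_range, gs_sign, ← Complex.ofReal_prod, gs_sin_prod]

lemma gs_quad (K : ℕ) [Fact K.Prime] (hK : K ≠ 2) (ψ : AddChar (ZMod K) ℂ)
    (hψ : ψ ≠ 1) (a : ZMod K) (ha : a ≠ 0) :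
    ∑ x : ZMod K, ψ (a * x ^ 2) = (quadraticChar (ZMod K) a : ℂ)
      * gaussSum ((quadraticChar (ZMod K)).ringHomComp (Int.castRingHom ℂ)) ψ := by
  have hF : ringChar (ZMod K) ≠ 2 := by rwa [ZMod.ringChar_zmod_n]
  have hprim := AddChar.IsPrimitive.of_ne_one hψ
  have h1 : ∑ x : ZMod K, ψ (a * x ^ 2)
      = ∑ y : ZMod K, ((quadraticChar (ZMod K) y : ℂ) + 1) * ψ (a * y) := by
    rw [← Finset.sum_fiberwise' Finset.univ (fun x : ZMod K => x ^ 2) (fun y => ψ (a * y))]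
    refine Finset.sum_congr rfl fun y _ => ?_
    rw [Finset.sum_const, nsmul_eq_mul]
    congr 1
    have := quadraticChar_card_sqrts hF y
    have h2 : ({x : ZMod K | x ^ 2 = y} : Set (ZMod K)).toFinset
      = Finset.univ.filter (fun x => x ^ 2 = y) := by ext; simp
    rw [h2] at this
    exact_mod_cast this
  have h0 : ∑ y : ZMod K, ψ (a * y) = 0 := by
    have := AddChar.sum_mulShift a hprim
    simp only [ha, if_false, mul_comm _ a, Nat.cast_zero] at this
    exact this
  have h3 := gaussSum_mulShift ((quadraticChar (ZMod K)).ringHomComp (Int.castRingHom ℂ)) ψ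
    (Units.mk0 a ha)
  have h4 : (quadraticChar (ZMod K) a : ℂ) * (quadraticChar (ZMod K) a : ℂ) = 1 := by
    have := quadraticChar_sq_one ha
    rw [sq] at this
    exact_mod_cast this
  rw [← h3, h1]
  simp only [add_mul, one_mul, Finset.sum_add_distrib, h0, add_zero, gaussSum,
    MulChar.ringHomComp_apply, AddChar.mulShift_apply, Units.val_mk0, eq_intCast]
  rw [← mul_assoc, h4, one_mul]

lemma gs_value (n : ℕ) [Fact (2 * n + 1).Prime] :
    ∑ x : ZMod (2 * n + 1), ZMod.stdAddChar (x ^ 2)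
      = (if Even n then 1 else Complex.I) * (Real.sqrt (2 * n + 1) : ℂ) := by
  have hP : (2 * n + 1).Prime := Fact.out
  have hn : 0 < n := by
    rcases Nat.eq_zero_or_pos n with rfl | h
    · exact absurd hP (by norm_num)
    · exact h
  have hF : ringChar (ZMod (2 * n + 1)) ≠ 2 := by rw [ZMod.ringChar_zmod_n]; omega
  set ζ : ℂ := Complex.exp (2 * Real.pi * Complex.I / (2 * n + 1 : ℕ)) with hζ
  have hprimζ : IsPrimitiveRoot ζ (2 * n + 1) := Complex.isPrimitiveRoot_exp (2 * n + 1) (by omega)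
  have hψp := ZMod.isPrimitive_stdAddChar (2 * n + 1)
  have hψ1 : (ZMod.stdAddChar : AddChar (ZMod (2 * n + 1)) ℂ) ≠ 1 := by
    have := hψp one_ne_zero
    rwa [AddChar.mulShift_one] at this
  have hval : ∀ x : ZMod (2 * n + 1), ZMod.stdAddChar x = ζ ^ x.val := by
    intro x
    have h := ZMod.stdAddChar_coe (N := 2 * n + 1) (x.val : ℤ)
    rw [Int.cast_natCast, ZMod.natCast_val, ZMod.cast_id', id] at h
    rw [h, hζ, ← Complex.exp_nat_mul]
    congr 1
    push_cast
    ring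
  rw [← gs_prod n ζ hζ]
  set P := ∏ k ∈ Finset.range n, (ζ ^ ((2 * n - k) * (n + 1)) - ζ ^ ((k + 1) * (n + 1))) with hPdef
  set G := ∑ x : ZMod (2 * n + 1), ZMod.stdAddChar (x ^ 2) with hG
  have hG2 : G ^ 2 = (-1) ^ n * (2 * n + 1) := by
    have h1 := gs_quad (2 * n + 1) (by omega) ZMod.stdAddChar hψ1 1 one_ne_zero
    simp only [one_mul, map_one, Int.cast_one] at h1
    rw [hG, h1, gaussSum_sq _ ((quadraticChar_isQuadratic _).comp _) hψp]
    · rw [MulChar.ringHomComp_apply, quadraticChar_neg_one hF, ZMod.card,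
        ZMod.χ₄_eq_neg_one_pow (by omega), show (2 * n + 1) / 2 = n by omega]
      simp
    · rw [Ne, MulChar.ringHomComp_eq_one_iff Int.cast_injective]
      exact quadraticChar_ne_one hF
  have hP2 : P ^ 2 = (-1) ^ n * (2 * n + 1) := by
    rw [hPdef, gs_prod n ζ hζ, mul_pow, ← Complex.ofReal_pow, Real.sq_sqrt (by positivity)]
    push_cast
    congr 1
    split_ifs with h
    · simp [h.neg_one_pow]
    · simp [(Nat.not_even_iff_odd.1 h).neg_one_pow]
  have key : ∀ e : ℤ, G = e * P → (e : ZMod (2 * n + 1)) = 1 := by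
    intro e he
    let f : ℤ[X] := ∑ x : ZMod (2 * n + 1), X ^ (x ^ 2).val
      - C e * ∏ k ∈ Finset.range n, (X ^ ((2 * n - k) * (n + 1)) - X ^ ((k + 1) * (n + 1)))
    have hf : aeval ζ f = 0 := by
      simp only [f, map_sub, map_sum, map_mul, map_prod, map_pow, aeval_X, aeval_C]
      rw [← hPdef]
      simp only [← hval]
      rw [← hG, he]
      simp
    have hd := minpoly.isIntegrallyClosed_dvd (hprimζ.isIntegral (by omega)) hf
    rw [← cyclotomic_eq_minpoly hprimζ (by omega)] at hd
    have hd2 := Polynomial.map_dvd (Int.castRingHom (ZMod (2 * n + 1))) hd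
    have hcyc : cyclotomic (2 * n + 1) (ZMod (2 * n + 1)) = (X - 1) ^ (2 * n) := by
      have := cyclotomic_mul_prime_eq_pow_of_not_dvd (ZMod (2 * n + 1)) (p := 2 * n + 1) (n := 1)
        (by intro h; have := Nat.le_of_dvd one_pos h; omega)
      rw [one_mul, cyclotomic_one] at this
      exact this
    rw [map_cyclotomic, hcyc] at hd2
    obtain ⟨q, hq⟩ := hd2
    refine gs_eps n hn _ q ?_
    rw [← hq]
    simp [f, Polynomial.map_sum, Polynomial.map_prod]
  rcases sq_eq_sq_iff_eq_or_eq_neg.1 (hG2.trans hP2.symm) with h | h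
  · exact h
  · exfalso
    have := key (-1) (by rw [h]; simp)
    have h2 : ((2 : ℕ) : ZMod (2 * n + 1)) = 0 := by
      push_cast at this ⊢
      linear_combination -this
    rw [ZMod.natCast_eq_zero_iff] at h2
    have := Nat.le_of_dvd two_pos h2
    omega

lemma gs_reindex (K : ℕ) [NeZero K] (hKodd : Odd K) (g : ZMod K → ℂ) :
    ∑ β ∈ (Finset.Ioc (-(K : ℤ)) (K : ℤ)).filter (fun β => Odd β), g (β : ZMod K)
      = ∑ x : ZMod K, g x := by
  obtain ⟨n, rfl⟩ := hKodd
  refine Finset.sum_bij (fun β _ => (β : ZMod (2 * n + 1))) (fun _ _ => Finset.mem_univ _) ?_ ?_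
    (fun _ _ => rfl)
  · intro a ha b hb hab
    simp only [Finset.mem_filter, Finset.mem_Ioc] at ha hb
    obtain ⟨⟨ha1, ha2⟩, a', ha'⟩ := ha
    obtain ⟨⟨hb1, hb2⟩, b', hb'⟩ := hb
    obtain ⟨c, hc⟩ := (ZMod.intCast_eq_intCast_iff_dvd_sub a b (2 * n + 1)).1 hab
    push_cast at *
    have hc2 : c % 2 = 0 := by
      by_contra h
      have h1 : c % 2 = 1 := by omega
      have : ((2 * (n : ℤ) + 1) * c) % 2 = 1 := by
        rw [Int.mul_emod, h1]; omega
      omega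
    obtain ⟨d, rfl⟩ : ∃ d, c = 2 * d := ⟨c / 2, by omega⟩
    have hd : d = 0 := by
      by_contra h
      rcases lt_or_gt_of_ne h with h | h
      · have : d ≤ -1 := by omega
        nlinarith
      · have : 1 ≤ d := by omega
        nlinarith
    subst hd
    omega
  · intro x _
    have hx := ZMod.val_lt x
    have hxv : ((x.val : ℤ) : ZMod (2 * n + 1)) = x := by simp
    have hKz : (2 * (n : ZMod (2 * n + 1)) + 1) = 0 := by
      have := ZMod.natCast_self (2 * n + 1)
      push_cast at this; exact this
    rcases Nat.even_or_odd' x.val with ⟨v, hv | hv⟩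
    · by_cases h0 : x.val = 0
      · refine ⟨2 * n + 1, ?_, ?_⟩
        · simp only [Finset.mem_filter, Finset.mem_Ioc]
          push_cast
          exact ⟨by omega, n, rfl⟩
        · push_cast
          rw [hKz, ← hxv, h0]; simp
      · refine ⟨x.val - (2 * n + 1), ?_, ?_⟩
        · simp only [Finset.mem_filter, Finset.mem_Ioc]
          push_cast
          exact ⟨by omega, v - n - 1, by omega⟩
        · rw [Int.cast_sub, hxv]
          push_cast
          rw [hKz, sub_zero]
    · refine ⟨x.val, ?_, hxv⟩
      simp only [Finset.mem_filter, Finset.mem_Ioc]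
      push_cast
      exact ⟨by omega, v, by omega⟩

theorem stmt4 (K : ℕ) (hK : K.Prime) (hKodd : Odd K)
    (ζ : ℂ) (hζ : ζ = Complex.exp (2 * Real.pi * Complex.I / K))
    (p m : ℤ) (hp : ¬ (K : ℤ) ∣ p)
    (fourstar pstar : ℤ)
    (h4 : 4 * fourstar ≡ 1 [ZMOD (K : ℤ)]) (hps : p * pstar ≡ 1 [ZMOD (K : ℤ)])
    (κ : ℤ) (hκ1 : K % 4 = 1 → κ = 1) (hκ3 : K % 4 = 3 → κ = -1) :
    ∑ β ∈ (Finset.Ioc (-(K : ℤ)) (K : ℤ)).filter (fun β => Odd β),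
        ζ ^ (fourstar * p * β ^ 2 + m * β)
      = (@legendreSym K ⟨hK⟩ |p| : ℂ)
        * Complex.exp (Real.pi * Complex.I / 4 * ((1 - κ : ℤ) : ℂ) * (p.sign : ℂ))
        * (Real.sqrt K : ℂ) * ζ ^ (-(m ^ 2 * pstar)) := by
  have : Fact K.Prime := ⟨hK⟩
  have hK2 : K ≠ 2 := by rintro rfl; exact absurd hKodd (by decide)
  have hK0 : (K : ℂ) ≠ 0 := by exact_mod_cast hK.ne_zero
  have hpow : ∀ j : ℤ, ζ ^ j = ZMod.stdAddChar (j : ZMod K) := by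
    intro j
    rw [ZMod.stdAddChar_coe, hζ, ← Complex.exp_int_mul]
    congr 1
    ring
  have hψ1 : (ZMod.stdAddChar : AddChar (ZMod K) ℂ) ≠ 1 := by
    have := ZMod.isPrimitive_stdAddChar K one_ne_zero
    rwa [AddChar.mulShift_one] at this
  have h4' : 4 * (fourstar : ZMod K) = 1 := by
    have := (ZMod.intCast_eq_intCast_iff _ _ _).2 h4
    push_cast at this; exact this
  have hps' : (p : ZMod K) * pstar = 1 := by
    have := (ZMod.intCast_eq_intCast_iff _ _ _).2 hps
    push_cast at this; exact this
  have hp0 : (p : ZMod K) ≠ 0 := left_ne_zero_of_mul_eq_one hps'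
  have hval : ∑ x : ZMod K, ZMod.stdAddChar (x ^ 2)
      = (if K % 4 = 1 then 1 else Complex.I) * (Real.sqrt K : ℂ) := by
    obtain ⟨n, rfl⟩ := hKodd
    rw [gs_value n]
    have : Even n ↔ (2 * n + 1) % 4 = 1 := by rw [Nat.even_iff]; omega
    simp only [this]
    push_cast
    rfl
  have hsum : ∑ β ∈ (Finset.Ioc (-(K : ℤ)) (K : ℤ)).filter (fun β => Odd β),
        ζ ^ (fourstar * p * β ^ 2 + m * β)
      = (legendreSym K p : ℂ) * (∑ x : ZMod K, ZMod.stdAddChar (x ^ 2))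
        * ζ ^ (-(m ^ 2 * pstar)) := by
    have h1 := gs_quad K hK2 ZMod.stdAddChar hψ1 1 one_ne_zero
    have h2 := gs_quad K hK2 ZMod.stdAddChar hψ1 p hp0
    simp only [one_mul, map_one, Int.cast_one] at h1
    rw [← h1] at h2
    rw [legendreSym, ← h2, Finset.sum_mul]
    simp only [hpow]
    push_cast
    rw [gs_reindex K hKodd (fun x : ZMod K => ZMod.stdAddChar
      ((fourstar : ZMod K) * (p : ZMod K) * x ^ 2 + (m : ZMod K) * x))]
    have hbij : Function.Bijective (fun y : ZMod K => 2 * y - 2 * (m : ZMod K) * (pstar : ZMod K)) := by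
      rw [← Finite.injective_iff_bijective]
      intro a b hab
      simp only at hab
      linear_combination 2 * (fourstar : ZMod K) * hab - (a - b) * h4'
    rw [← hbij.sum_comp]
    refine Finset.sum_congr rfl fun y _ => ?_
    rw [← AddChar.map_add_eq_mul]
    congr 1
    linear_combination (p : ZMod K) * (y - m * pstar) ^ 2 * h4'
      + ((m : ZMod K) ^ 2 * pstar - 2 * y * m) * hps'
  rw [hsum, hval]
  rcases lt_or_gt_of_ne (show p ≠ 0 by rintro rfl; simp at hp) with hneg | hpos
  · rw [abs_of_neg hneg, Int.sign_eq_neg_one_of_neg hneg, legendreSym.at_neg hK2]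
    by_cases hm : K % 4 = 1
    · rw [hκ1 hm, ZMod.χ₄_nat_one_mod_four hm]
      simp [hm]
    · have hm3 : K % 4 = 3 := by rcases hKodd with ⟨n, rfl⟩; omega
      rw [hκ3 hm3, ZMod.χ₄_nat_three_mod_four hm3]
      have e : Complex.exp (Real.pi * Complex.I / 4 * ((1 - -1 : ℤ) : ℂ) * ((-1 : ℤ) : ℂ))
          = -Complex.I := by
        rw [show (Real.pi * Complex.I / 4 * ((1 - -1 : ℤ) : ℂ) * ((-1 : ℤ) : ℂ))
          = -(Real.pi / 2 * Complex.I) by push_cast; ring, Complex.exp_neg,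
          Complex.exp_pi_div_two_mul_I, Complex.inv_I]
      rw [e, if_neg hm]
      push_cast
      ring
  · rw [abs_of_pos hpos, Int.sign_eq_one_of_pos hpos]
    by_cases hm : K % 4 = 1
    · rw [hκ1 hm]
      simp [hm]
    · have hm3 : K % 4 = 3 := by rcases hKodd with ⟨n, rfl⟩; omega
      rw [hκ3 hm3]
      have e : Complex.exp (Real.pi * Complex.I / 4 * ((1 - -1 : ℤ) : ℂ) * ((1 : ℤ) : ℂ))
          = Complex.I := by
        rw [show (Real.pi * Complex.I / 4 * ((1 - -1 : ℤ) : ℂ) * ((1 : ℤ) : ℂ))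
          = (Real.pi / 2 * Complex.I) by push_cast; ring,
          Complex.exp_pi_div_two_mul_I]
      rw [e, if_neg hm]
      push_cast
      ring
end

section
/- Let K be an odd prime, ζ = exp(2πi/K), and let p, m ∈ ℤ with p not divisible by K. Let 4*, p* ∈ ℤ satisfy 4·4* ≡ 1 (mod K) and p·p* ≡ 1 (mod K), and let κ = 1 if K ≡ 1 (mod 4), κ = −1 if K ≡ 3 (mod 4). Define X = K^{−1/2} · e^{−(iπ/4)(1−κ)·sign(p)} · ( Σ_{0<β<K, β odd} ζ^{4*·p·β²}·(ζ^{m·β} + ζ^{−m·β}) + (1/2)·ζ^{4*·p·K²}·(ζ^{m·K} + ζ^{−m·K}) ). Then X = (|p|/K) · ζ^{−m²·p*}; in particular X ∈ ℤ[ζ]. -/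
/-- Gaussian binomials by the Pascal recursion. -/
def qB {F : Type*} [CommRing F] (q : F) : ℕ → ℕ → F
  | _, 0 => 1
  | 0, _ + 1 => 0
  | n + 1, j + 1 => q ^ (j + 1) * qB q n (j + 1) + qB q n j

theorem qB_zero_right {F : Type*} [CommRing F] (q : F) (n : ℕ) : qB q n 0 = 1 := by
  cases n <;> rfl

theorem qB_succ {F : Type*} [CommRing F] (q : F) (n j : ℕ) :
    qB q (n + 1) (j + 1) = q ^ (j + 1) * qB q n (j + 1) + qB q n j := rfl

theorem qB_zero_of_lt {F : Type*} [CommRing F] (q : F) (n j : ℕ) (h : n < j) : qB q n j = 0 := by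
  induction n generalizing j with
  | zero => obtain ⟨i, rfl⟩ : ∃ i, j = i + 1 := ⟨j - 1, by omega⟩
            rfl
  | succ n ih =>
    obtain ⟨i, rfl⟩ : ∃ i, j = i + 1 := ⟨j - 1, by omega⟩
    rw [qB_succ, ih _ (by omega), ih _ (by omega)]; ring

theorem qB_absorb {F : Type*} [CommRing F] (q : F) (n j : ℕ) :
    (1 - q ^ (j + 1)) * qB q (n + 1) (j + 1) = (1 - q ^ (n + 1)) * qB q n j := by
  induction n generalizing j with
  | zero =>
    rw [qB_succ, qB_zero_of_lt q 0 (j + 1) (by omega)]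
    cases j with
    | zero => simp
    | succ i => rw [qB_zero_of_lt q 0 (i + 1) (by omega)]; simp
  | succ n ih =>
    rw [qB_succ q (n + 1) j]
    cases j with
    | zero =>
      have := ih 0
      simp only [qB_zero_right] at *
      linear_combination q * this
    | succ i =>
      have h1 := ih (i + 1)
      have h2 := ih i
      have h3 := qB_succ q n i
      linear_combination q ^ (i + 2) * h1 - q * (1 - q ^ (n + 1)) * h3 + q * h2

theorem qB_alt {F : Type*} [CommRing F] (q : F) (n : ℕ) :
    ∑ j ∈ Finset.range (n + 3), (-1) ^ j * qB q (n + 2) j =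
      (1 - q ^ (n + 1)) * ∑ j ∈ Finset.range (n + 1), (-1) ^ j * qB q n j := by
  have e1 : ∑ j ∈ Finset.range (n + 3), (-1) ^ j * qB q (n + 2) j
      = 1 + ∑ j ∈ Finset.range (n + 2), (-1) ^ (j + 1) * (q ^ (j + 1) * qB q (n + 1) (j + 1))
        + ∑ j ∈ Finset.range (n + 2), (-1) ^ (j + 1) * qB q (n + 1) j := by
    rw [Finset.sum_range_succ', add_assoc, ← Finset.sum_add_distrib, add_comm, qB_zero_right]
    simp only [pow_zero, one_mul, qB_succ, mul_add]
  have e2 : 1 + ∑ j ∈ Finset.range (n + 2), (-1) ^ (j + 1) * (q ^ (j + 1) * qB q (n + 1) (j + 1))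
      = ∑ j ∈ Finset.range (n + 2), (-1) ^ j * (q ^ j * qB q (n + 1) j) := by
    have := Finset.sum_range_succ' (fun j => (-1) ^ j * (q ^ j * qB q (n + 1) j)) (n + 2)
    rw [Finset.sum_range_succ, qB_zero_of_lt q (n + 1) (n + 2) (by omega)] at this
    simp only [qB_zero_right] at this
    linear_combination -this
  rw [e1, e2, ← Finset.sum_add_distrib, Finset.sum_range_succ', Finset.mul_sum, qB_zero_right]
  simp only [pow_zero, mul_one, zero_add, pow_one]
  rw [show (1 + -1 : F) = 0 by ring, add_zero]
  refine Finset.sum_congr rfl fun j _ => ?_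
  have := qB_absorb q n j
  linear_combination (-1) ^ j * this

theorem qB_gauss {F : Type*} [CommRing F] (q : F) (h : ℕ) :
    ∑ j ∈ Finset.range (2 * h + 1), (-1) ^ j * qB q (2 * h) j =
      ∏ k ∈ Finset.range h, (1 - q ^ (2 * k + 1)) := by
  induction h with
  | zero => simp [qB_zero_right]
  | succ h ih =>
    rw [Finset.prod_range_succ, ← ih, mul_comm _ (1 - q ^ (2 * h + 1))]
    exact qB_alt q (2 * h)

theorem gauss_prod (h : ℕ) (z : ℂ) (hz : IsPrimitiveRoot z (2 * h + 1)) :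
    ∑ j ∈ Finset.range (2 * h + 1), z ^ (j * (j + 1)) =
      ∏ k ∈ Finset.range h, (1 - ((z ^ 2)⁻¹) ^ (2 * k + 1)) := by
  have hz0 : z ≠ 0 := hz.ne_zero (by omega)
  rw [← qB_gauss]
  refine Finset.sum_congr rfl fun j hj => ?_
  have hq : IsPrimitiveRoot ((z ^ 2)⁻¹) (2 * h + 1) :=
    (hz.pow_of_coprime 2 (by simp)).inv
  induction j with
  | zero => simp [qB_zero_right]
  | succ j ih =>
    have ih := ih (by simp at *; omega)
    simp only [Finset.mem_range] at hj
    have h1 := qB_absorb ((z ^ 2)⁻¹) (2 * h) j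
    rw [hq.pow_eq_one, sub_self, zero_mul, mul_eq_zero] at h1
    have h2 : 1 - ((z ^ 2)⁻¹) ^ (j + 1) ≠ 0 := by
      rw [sub_ne_zero]
      exact (hq.pow_ne_one_of_pos_of_lt (by omega) (by omega)).symm
    have h3 := h1.resolve_left h2
    rw [qB_succ] at h3
    have h4 : (z ^ 2) ^ (j + 1) * ((z ^ 2)⁻¹) ^ (j + 1) = 1 := by
      rw [← mul_pow, mul_inv_cancel₀ (pow_ne_zero _ hz0), one_pow]
    have h5 : z ^ ((j + 1) * (j + 1 + 1)) = z ^ (j * (j + 1)) * (z ^ 2) ^ (j + 1) := by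
      rw [← pow_mul, ← pow_add]; congr 1; ring
    rw [h5, ih]
    linear_combination (-1) ^ j * (z ^ 2) ^ (j + 1) * h3 -
      (-1) ^ j * qB ((z ^ 2)⁻¹) (2 * h) (j + 1) * h4

theorem gauss_prod2 (h : ℕ) (z : ℂ) (hz : IsPrimitiveRoot z (2 * h + 1)) :
    ∑ j ∈ Finset.range (2 * h + 1), z ^ ((j + h + 1) ^ 2) =
      ∏ k ∈ Finset.range h, (z ^ (2 * k + 1) - (z ^ (2 * k + 1))⁻¹) := by
  have hz0 : z ≠ 0 := hz.ne_zero (by omega)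
  have e : ∀ h : ℕ, z ^ (h ^ 2) = ∏ k ∈ Finset.range h, z ^ (2 * k + 1) := by
    intro h
    induction h with
    | zero => simp
    | succ h ih => rw [Finset.prod_range_succ, ← ih, ← pow_add]; congr 1; ring
  have e2 : ∀ j, z ^ ((j + h + 1) ^ 2) = z ^ (h ^ 2) * z ^ (j * (j + 1)) := by
    intro j
    rw [show (j + h + 1) ^ 2 = (2 * h + 1) * (j + 1) + (h ^ 2 + j * (j + 1)) by ring, pow_add,
      pow_mul, hz.pow_eq_one, one_pow, one_mul, pow_add]
  simp only [e2]
  rw [← Finset.mul_sum, gauss_prod h z hz, e, ← Finset.prod_mul_distrib]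
  refine Finset.prod_congr rfl fun k _ => ?_
  have : z ^ (2 * k + 1) ≠ 0 := pow_ne_zero _ hz0
  rw [inv_pow, pow_right_comm z 2]
  field_simp

theorem sin_term (K i : ℕ) (z : ℂ) (hz : z = Complex.exp (2 * Real.pi * Complex.I / K)) :
    z ^ i - (z ^ i)⁻¹ = Complex.I * ((2 * Real.sin (2 * Real.pi * i / K) : ℝ) : ℂ) := by
  rw [hz, ← Complex.exp_nat_mul, ← Complex.exp_neg]
  push_cast
  rw [Complex.sin]
  have e : (i : ℂ) * (2 * Real.pi * Complex.I / K) = (2 * Real.pi * i / K) * Complex.I := by ring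
  rw [e, neg_mul]
  linear_combination (Complex.exp ((2 * Real.pi * i / K) * Complex.I) - Complex.exp (-((2 * Real.pi * i / K) * Complex.I))) * (Complex.I_sq)

theorem sin_pos' (K i : ℕ) (h0 : 0 < i) (h : 2 * i < K) : 0 < 2 * Real.sin (2 * Real.pi * i / K) := by
  have hK : (0 : ℝ) < K := by exact_mod_cast (by omega : 0 < K)
  have hi : (0 : ℝ) < i := by exact_mod_cast h0
  have h' : (2 : ℝ) * i < K := by exact_mod_cast h
  have := Real.sin_pos_of_pos_of_lt_pi (x := 2 * Real.pi * i / K) (by positivity)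
    (by rw [div_lt_iff₀ hK]; nlinarith [Real.pi_pos])
  linarith

theorem sin_neg' (K i : ℕ) (h0 : K < 2 * i) (h : i < K) : 0 < -(2 * Real.sin (2 * Real.pi * i / K)) := by
  have hK : (0 : ℝ) < K := by exact_mod_cast (by omega : 0 < K)
  have h0' : (K : ℝ) < 2 * i := by exact_mod_cast h0
  have h' : (i : ℝ) < K := by exact_mod_cast h
  have := Real.sin_neg_of_neg_of_neg_pi_lt (x := 2 * Real.pi * i / K - 2 * Real.pi)
    (by rw [sub_neg, div_lt_iff₀ hK]; nlinarith [Real.pi_pos])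
    (by rw [lt_sub_iff_add_lt, lt_div_iff₀ hK]; nlinarith [Real.pi_pos])
  rw [Real.sin_sub_two_pi] at this
  linarith

theorem prod_first (K a : ℕ) (z : ℂ) (hz : z = Complex.exp (2 * Real.pi * Complex.I / K))
    (h : 4 * a < K + 2) :
    ∃ r : ℝ, 0 < r ∧ ∏ k ∈ Finset.range a, (z ^ (2 * k + 1) - (z ^ (2 * k + 1))⁻¹)
      = Complex.I ^ a * r := by
  refine ⟨∏ k ∈ Finset.range a, (2 * Real.sin (2 * Real.pi * (2 * k + 1 : ℕ) / K)),
    Finset.prod_pos fun k hk => sin_pos' K _ (by omega) (by simp at hk; omega), ?_⟩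
  rw [Finset.prod_congr rfl fun k _ => sin_term K (2 * k + 1) z hz, Finset.prod_mul_distrib]
  simp

theorem prod_second (K b a : ℕ) (z : ℂ) (hz : z = Complex.exp (2 * Real.pi * Complex.I / K))
    (h : K < 4 * b + 2) (h2 : 2 * (a + b) < K + 1) :
    ∃ r : ℝ, 0 < r ∧ ∏ k ∈ Finset.range a, (z ^ (2 * (b + k) + 1) - (z ^ (2 * (b + k) + 1))⁻¹)
      = (-Complex.I) ^ a * r := by
  refine ⟨∏ k ∈ Finset.range a, (-(2 * Real.sin (2 * Real.pi * (2 * (b + k) + 1 : ℕ) / K))),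
    Finset.prod_pos fun k hk => sin_neg' K _ (by omega) (by simp at hk; omega), ?_⟩
  have e : ∀ k ∈ Finset.range a, z ^ (2 * (b + k) + 1) - (z ^ (2 * (b + k) + 1))⁻¹ =
      (-Complex.I) *
        ((-(2 * Real.sin (2 * Real.pi * (2 * (b + k) + 1 : ℕ) / K)) : ℝ) : ℂ) := by
    intro k _
    rw [sin_term K (2 * (b + k) + 1) z hz, Complex.ofReal_neg, neg_mul_neg]
  rw [Finset.prod_congr rfl e, Finset.prod_mul_distrib, Finset.prod_const, Finset.card_range,
    Complex.ofReal_prod]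

theorem prod_sign (h : ℕ) (z : ℂ) (hz : z = Complex.exp (2 * Real.pi * Complex.I / (2 * h + 1 : ℕ))) :
    ∃ r : ℝ, 0 < r ∧ ∏ k ∈ Finset.range h, (z ^ (2 * k + 1) - (z ^ (2 * k + 1))⁻¹)
      = (if Even h then 1 else Complex.I) * r := by
  split_ifs with he
  · obtain ⟨a, rfl⟩ := he
    obtain ⟨r, hr, e1⟩ := prod_first _ a z hz (by omega)
    obtain ⟨s, hs, e2⟩ := prod_second _ a a z hz (by omega) (by omega)
    refine ⟨r * s, by positivity, ?_⟩
    rw [Finset.prod_range_add, e1, e2]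
    have : Complex.I ^ a * (-Complex.I) ^ a = 1 := by rw [← mul_pow]; simp
    push_cast
    linear_combination (r : ℂ) * s * this
  · obtain ⟨a, rfl⟩ := Nat.not_even_iff_odd.mp he
    rw [show 2 * a + 1 = (a + 1) + a by ring] at *
    obtain ⟨r, hr, e1⟩ := prod_first _ (a + 1) z hz (by omega)
    obtain ⟨s, hs, e2⟩ := prod_second _ (a + 1) a z hz (by omega) (by omega)
    refine ⟨r * s, by positivity, ?_⟩
    rw [Finset.prod_range_add, e1, e2]
    have : Complex.I ^ a * (-Complex.I) ^ a = 1 := by rw [← mul_pow]; simp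
    push_cast
    linear_combination (r : ℂ) * s * Complex.I * this

theorem sum_range_zmod (K : ℕ) [NeZero K] (f : ZMod K → ℂ) :
    ∑ n ∈ Finset.range K, f (n : ZMod K) = ∑ x, f x := by
  refine Finset.sum_nbij' (fun n => (n : ZMod K)) (fun x => x.val) ?_ ?_ ?_ ?_ ?_
  · intro n _; simp
  · intro x _; simpa using ZMod.val_lt x
  · intro n hn; exact ZMod.val_cast_of_lt (by simpa using hn)
  · intro x _; simp
  · intro n _; rfl

theorem sum_odd_range (h : ℕ) (f : ℕ → ℂ) :
    ∑ n ∈ Finset.range (2 * h + 1), f n =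
      f 0 + ∑ k ∈ Finset.range h, (f (2 * k + 1) + f (2 * k + 2)) := by
  induction h with
  | zero => simp
  | succ h ih =>
    rw [show 2 * (h + 1) + 1 = 2 * h + 1 + 1 + 1 by ring, Finset.sum_range_succ,
      Finset.sum_range_succ, ih, Finset.sum_range_succ]
    ring

theorem sum_odd_Ioo (h : ℕ) (f : ℤ → ℂ) :
    ∑ β ∈ (Finset.Ioo (0 : ℤ) ((2 * h + 1 : ℕ) : ℤ)).filter (fun β => Odd β), f β =
      ∑ k ∈ Finset.range h, f (2 * k + 1) := by
  symm
  refine Finset.sum_nbij' (fun k => 2 * (k : ℤ) + 1) (fun b => (b / 2).toNat) ?_ ?_ ?_ ?_ ?_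
  · intro n hn
    simp only [Finset.mem_range, Finset.mem_filter, Finset.mem_Ioo] at *
    refine ⟨by omega, ⟨n, rfl⟩⟩
  · intro b hb
    simp only [Finset.mem_range, Finset.mem_filter, Finset.mem_Ioo] at *
    obtain ⟨hb, c, rfl⟩ := hb
    omega
  · intro n hn; omega
  · intro b hb
    simp only [Finset.mem_filter, Finset.mem_Ioo] at *
    obtain ⟨hb, c, rfl⟩ := hb
    omega
  · intro n _; rfl

theorem sum_all (h : ℕ) (f : ZMod (2 * h + 1) → ℂ) :
    ∑ β ∈ (Finset.Ioo (0 : ℤ) ((2 * h + 1 : ℕ) : ℤ)).filter (fun β => Odd β),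
      (f (β : ZMod (2 * h + 1)) + f (-(β : ZMod (2 * h + 1)))) + f 0 = ∑ x, f x := by
  rw [sum_odd_Ioo h (fun β => f (β : ZMod (2 * h + 1)) + f (-(β : ZMod (2 * h + 1)))),
    ← sum_range_zmod, sum_odd_range h (fun n => f (n : ZMod (2 * h + 1))), add_comm,
    Finset.sum_add_distrib, Finset.sum_add_distrib]
  rw [← Finset.sum_range_reflect (fun k => f ((2 * k + 2 : ℕ) : ZMod (2 * h + 1)))]
  simp only [Nat.cast_zero]
  congr 2
  · refine Finset.sum_congr rfl fun k hk => ?_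
    congr 1
    have hk := Finset.mem_range.mp hk
    have : ((2 * (h - 1 - k) + 2 : ℕ) : ZMod (2 * h + 1)) + ((2 * k + 1 : ℕ) : ZMod (2 * h + 1))
        = 0 := by
      rw [← Nat.cast_add, show 2 * (h - 1 - k) + 2 + (2 * k + 1) = 2 * h + 1 by omega,
        ZMod.natCast_self]
    rw [eq_neg_of_add_eq_zero_left this]
    push_cast; rfl

theorem quad_sum (K : ℕ) [Fact K.Prime] (hK : K ≠ 2) (c : ZMod K) (hc : c ≠ 0) :
    ∑ x : ZMod K, ZMod.stdAddChar (c * x ^ 2) =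
      (quadraticChar (ZMod K) c : ℂ) *
        gaussSum ((quadraticChar (ZMod K)).ringHomComp (Int.castRingHom ℂ)) ZMod.stdAddChar := by
  have hF : ringChar (ZMod K) ≠ 2 := by rwa [ZMod.ringChar_zmod_n]
  have e1 : ∑ x : ZMod K, ZMod.stdAddChar (c * x ^ 2) =
      ∑ y : ZMod K, ((quadraticChar (ZMod K) y + 1 : ℤ) : ℂ) * ZMod.stdAddChar (c * y) := by
    rw [← Finset.sum_fiberwise (s := Finset.univ) (g := fun x : ZMod K => x ^ 2)]
    refine Finset.sum_congr rfl fun y _ => ?_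
    rw [← quadraticChar_card_sqrts hF y]
    rw [Finset.sum_congr rfl (g := fun _ => ZMod.stdAddChar (c * y))
      (fun x hx => by rw [(Finset.mem_filter.mp hx).2])]
    rw [Finset.sum_const, nsmul_eq_mul]
    congr 1
    push_cast
    congr 2
    ext x; simp
  have e2 : ∑ y : ZMod K, (ZMod.stdAddChar (c * y) : ℂ) = 0 := by
    have := AddChar.sum_eq_zero_of_ne_one (ZMod.isPrimitive_stdAddChar K hc)
    simpa [AddChar.mulShift_apply] using this
  rw [e1]
  have e3 := gaussSum_mulShift ((quadraticChar (ZMod K)).ringHomComp (Int.castRingHom ℂ))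
    (ZMod.stdAddChar (N := K)) (Units.mk0 c hc)
  rw [← e3, ← mul_assoc]
  have e4 : (quadraticChar (ZMod K) c : ℂ) * 
    ((quadraticChar (ZMod K)).ringHomComp (Int.castRingHom ℂ)) (Units.mk0 c hc : (ZMod K)ˣ) = 1 := by
    have := quadraticChar_sq_one hc
    simp only [Units.val_mk0, MulChar.ringHomComp_apply, eq_intCast]
    rw [← Int.cast_mul, ← sq, this, Int.cast_one]
  rw [e4, one_mul, gaussSum]
  simp only [Int.cast_add, Int.cast_one, add_mul, one_mul, Finset.sum_add_distrib, e2, add_zero]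
  rfl

theorem std_eq (K : ℕ) [NeZero K] (n : ℤ) :
    ZMod.stdAddChar (n : ZMod K) = (Complex.exp (2 * Real.pi * Complex.I / K)) ^ n := by
  rw [ZMod.stdAddChar_coe, ← Complex.exp_int_mul]
  congr 1; ring

theorem gauss_value (h : ℕ) [Fact (2 * h + 1).Prime] :
    gaussSum ((quadraticChar (ZMod (2 * h + 1))).ringHomComp (Int.castRingHom ℂ))
      ZMod.stdAddChar = (if Even h then 1 else Complex.I) * (Real.sqrt (2 * h + 1 : ℕ) : ℂ) := by
  set z := Complex.exp (2 * Real.pi * Complex.I / (2 * h + 1 : ℕ)) with hz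
  have hF : ringChar (ZMod (2 * h + 1)) ≠ 2 := by rw [ZMod.ringChar_zmod_n]; omega
  have hprim : IsPrimitiveRoot z (2 * h + 1) := Complex.isPrimitiveRoot_exp _ (by omega)
  obtain ⟨r, hr, e⟩ := prod_sign h z hz
  rw [← gauss_prod2 h z hprim] at e
  have e1 := quad_sum (2 * h + 1) (by omega) 1 one_ne_zero
  simp only [one_mul, map_one, Int.cast_one] at e1
  have e2 : ∑ j ∈ Finset.range (2 * h + 1), z ^ ((j + h + 1) ^ 2) =
      ∑ x : ZMod (2 * h + 1), ZMod.stdAddChar (x ^ 2) := by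
    rw [← Equiv.sum_comp (Equiv.addRight ((h + 1 : ℕ) : ZMod (2 * h + 1))), ← sum_range_zmod]
    refine Finset.sum_congr rfl fun j _ => ?_
    have := std_eq (2 * h + 1) (((j + h + 1) ^ 2 : ℕ) : ℤ)
    rw [zpow_natCast, ← hz] at this
    rw [← this]
    simp [add_assoc]
  rw [← e1, ← e2, e]
  have sq := gaussSum_sq (χ := (quadraticChar (ZMod (2 * h + 1))).ringHomComp (Int.castRingHom ℂ))
    ((MulChar.ringHomComp_ne_one_iff (RingHom.injective_int _)).mpr (quadraticChar_ne_one hF))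
    ((quadraticChar_isQuadratic _).comp _) (ZMod.isPrimitive_stdAddChar (2 * h + 1))
  rw [← e1, ← e2, e, MulChar.ringHomComp_apply, quadraticChar_neg_one hF, ZMod.card] at sq
  suffices r = Real.sqrt (2 * h + 1 : ℕ) by rw [this]
  have hr2 : r ^ 2 = (2 * h + 1 : ℕ) := by
    split_ifs at sq with he
    · rw [ZMod.χ₄_nat_one_mod_four (by obtain ⟨a, rfl⟩ := he; omega)] at sq
      rw [← Complex.ofReal_inj]
      push_cast at sq ⊢
      simpa using sq
    · rw [ZMod.χ₄_nat_three_mod_four (by obtain ⟨a, rfl⟩ := Nat.not_even_iff_odd.mp he; omega)] at sq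
      rw [← Complex.ofReal_inj]
      rw [mul_pow, Complex.I_sq] at sq
      push_cast at sq ⊢
      simp at sq
      linear_combination -sq
  rw [← hr2, Real.sqrt_sq hr.le]



/-- For an odd prime `K`, `ζ = exp(2πi/K)`, `p, m ∈ ℤ` with `K ∤ p`, inverses
`4*`, `p*` of `4` and `p` mod `K`, and `κ = ±1` according to `K ≡ ±1 (mod 4)`,
the quantity
`X = K^{−1/2} e^{−(iπ/4)(1−κ)sign(p)} ( ∑_{0<β<K, β odd} ζ^{4*pβ²}(ζ^{mβ}+ζ^{−mβ})
      + ½ ζ^{4*pK²}(ζ^{mK}+ζ^{−mK}) )`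
equals `(|p|/K)·ζ^{−m²p*}`; in particular `X ∈ ℤ[ζ]`. -/
theorem stmt5 (K : ℕ) (hK : K.Prime) (hKodd : Odd K)
    (ζ : ℂ) (hζ : ζ = Complex.exp (2 * Real.pi * Complex.I / K))
    (p m : ℤ) (hp : ¬ (K : ℤ) ∣ p)
    (fourstar pstar : ℤ)
    (h4 : 4 * fourstar ≡ 1 [ZMOD (K : ℤ)]) (hps : p * pstar ≡ 1 [ZMOD (K : ℤ)])
    (κ : ℤ) (hκ1 : K % 4 = 1 → κ = 1) (hκ3 : K % 4 = 3 → κ = -1)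
    (X : ℂ)
    (hX : X = (Real.sqrt K : ℂ)⁻¹
        * Complex.exp (-(Real.pi * Complex.I / 4) * ((1 - κ : ℤ) : ℂ) * (p.sign : ℂ))
        * ((∑ β ∈ (Finset.Ioo (0 : ℤ) (K : ℤ)).filter (fun β => Odd β),
              ζ ^ (fourstar * p * β ^ 2) * (ζ ^ (m * β) + ζ ^ (-(m * β))))
            + (1 / 2) * ζ ^ (fourstar * p * (K : ℤ) ^ 2)
              * (ζ ^ (m * (K : ℤ)) + ζ ^ (-(m * (K : ℤ)))))) :
    X = (@legendreSym K ⟨hK⟩ |p| : ℂ) * ζ ^ (-(m ^ 2 * pstar))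
      ∧ X ∈ Subring.closure {ζ} := by 
  have : Fact K.Prime := ⟨hK⟩
  suffices hmain : X = (@legendreSym K ⟨hK⟩ |p| : ℂ) * ζ ^ (-(m ^ 2 * pstar)) by
    refine ⟨hmain, ?_⟩
    have hprim : IsPrimitiveRoot ζ K := hζ ▸ Complex.isPrimitiveRoot_exp _ hK.ne_zero
    have hmem : ζ ∈ Subring.closure {ζ} := Subring.subset_closure rfl
    have e : ζ ^ (-(m ^ 2 * pstar)) = ζ ^ ((-(m ^ 2 * pstar)) % (K : ℤ)).toNat := by
      rw [← zpow_natCast, Int.toNat_of_nonneg (Int.emod_nonneg _ (by exact_mod_cast hK.ne_zero))]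
      conv_lhs => rw [← Int.emod_add_mul_ediv (-(m ^ 2 * pstar)) K]
      rw [zpow_add₀ (hprim.ne_zero hK.ne_zero), zpow_mul, zpow_natCast, hprim.pow_eq_one, one_zpow,
        mul_one]
    rw [hmain, e]
    exact mul_mem (intCast_mem _ _) (pow_mem hmem _)
  obtain ⟨h, rfl⟩ := hKodd
  have hz : ∀ n : ℤ, ζ ^ n = ZMod.stdAddChar (n : ZMod (2 * h + 1)) := by
    intro n; rw [std_eq, hζ]
  have hζ0 : ζ ≠ 0 := hζ ▸ Complex.exp_ne_zero _
  have h4' : (4 : ZMod (2 * h + 1)) * fourstar = 1 := by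
    have := (ZMod.intCast_eq_intCast_iff _ _ _).mpr h4
    simpa using this
  have hps' : (p : ZMod (2 * h + 1)) * pstar = 1 := by
    have := (ZMod.intCast_eq_intCast_iff _ _ _).mpr hps
    simpa using this
  have hp0 : (p : ZMod (2 * h + 1)) ≠ 0 := left_ne_zero_of_mul_eq_one hps'
  have h40 : (fourstar : ZMod (2 * h + 1)) ≠ 0 := right_ne_zero_of_mul_eq_one h4'
  have h20 : (2 : ZMod (2 * h + 1)) ≠ 0 := by
    intro h2
    have : (4 : ZMod (2 * h + 1)) = 0 := by linear_combination 2 * h2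
    rw [this, zero_mul] at h4'
    exact zero_ne_one h4'
  set f : ZMod (2 * h + 1) → ℂ := fun x =>
    ZMod.stdAddChar ((fourstar : ZMod (2 * h + 1)) * (p : ZMod (2 * h + 1)) * x ^ 2 +
      (m : ZMod (2 * h + 1)) * x) with hf
  have hsum : (∑ β ∈ (Finset.Ioo (0 : ℤ) ((2 * h + 1 : ℕ) : ℤ)).filter (fun β => Odd β),
              ζ ^ (fourstar * p * β ^ 2) * (ζ ^ (m * β) + ζ ^ (-(m * β))))
            + (1 / 2) * ζ ^ (fourstar * p * ((2 * h + 1 : ℕ) : ℤ) ^ 2)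
              * (ζ ^ (m * ((2 * h + 1 : ℕ) : ℤ)) + ζ ^ (-(m * ((2 * h + 1 : ℕ) : ℤ)))) = ∑ x, f x := by
    rw [← sum_all]
    congr 1
    · refine Finset.sum_congr rfl fun β _ => ?_
      rw [mul_add, ← zpow_add₀ hζ0, ← zpow_add₀ hζ0, hz, hz, hf]
      push_cast
      simp only [neg_sq, mul_neg]
    · have hc : (((2 * h + 1 : ℕ) : ℤ) : ZMod (2 * h + 1)) = 0 := by
        rw [Int.cast_natCast, ZMod.natCast_self]
      rw [hz, hz, hz, hf]
      simp only [Int.cast_mul, Int.cast_pow, Int.cast_neg, hc]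
      norm_num
  have hsq : ∑ x, f x = ζ ^ (-(m ^ 2 * pstar)) *
      ∑ x : ZMod (2 * h + 1), ZMod.stdAddChar ((fourstar * p : ZMod (2 * h + 1)) * x ^ 2) := by
    rw [← Equiv.sum_comp (Equiv.addRight (2 * m * pstar : ZMod (2 * h + 1)))
      (fun x => (ZMod.stdAddChar ((fourstar * p : ZMod (2 * h + 1)) * x ^ 2) : ℂ)), Finset.mul_sum]
    refine Finset.sum_congr rfl fun x _ => ?_
    rw [hz, ← AddChar.map_add_eq_mul, hf]
    simp only [Equiv.coe_addRight]
    congr 1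
    push_cast
    generalize (m : ZMod (2 * h + 1)) = m, (p : ZMod (2 * h + 1)) = p,
      (pstar : ZMod (2 * h + 1)) = s, (fourstar : ZMod (2 * h + 1)) = c at *
    linear_combination (-4 * c * m * x - 4 * c * m ^ 2 * s) * hps' - (m * x + m ^ 2 * s) * h4'
  have hq : quadraticChar (ZMod (2 * h + 1)) (fourstar * p) = legendreSym (2 * h + 1) p := by
    have e : quadraticChar (ZMod (2 * h + 1)) 4 = 1 := by
      rw [show (4 : ZMod (2 * h + 1)) = 2 ^ 2 by norm_num]
      exact quadraticChar_sq_one' h20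
    have e2 := congrArg (quadraticChar (ZMod (2 * h + 1))) h4'
    rw [map_mul, e, one_mul, map_one] at e2
    rw [map_mul, e2, one_mul]; rfl
  have hs0 : (Real.sqrt (2 * h + 1 : ℕ) : ℂ) ≠ 0 := by
    rw [Complex.ofReal_ne_zero]
    exact (Real.sqrt_pos.mpr (by positivity)).ne'
  rw [hsum, hsq, quad_sum _ (by omega) _ (mul_ne_zero h40 hp0), hq, gauss_value] at hX
  have hkey : Complex.exp (-(Real.pi * Complex.I / 4) * ((1 - κ : ℤ) : ℂ) * (p.sign : ℂ)) *
      (legendreSym (2 * h + 1) p : ℂ) * (if Even h then 1 else Complex.I) =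
      (legendreSym (2 * h + 1) |p| : ℂ) := by
    have hpne : p ≠ 0 := by rintro rfl; simp at hp
    have hneg : legendreSym (2 * h + 1) (-p) =
        ZMod.χ₄ (2 * h + 1 : ℕ) * legendreSym (2 * h + 1) p := by
      rw [← legendreSym.at_neg_one (by omega), ← legendreSym.mul, neg_one_mul]
    split_ifs with he
    · have hm : (2 * h + 1) % 4 = 1 := by obtain ⟨a, rfl⟩ := he; omega
      rw [ZMod.χ₄_nat_one_mod_four hm, one_mul] at hneg
      rw [hκ1 hm]
      rcases abs_choice p with h' | h' <;> rw [h'] <;> simp [hneg]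
    · have hm : (2 * h + 1) % 4 = 3 := by obtain ⟨a, rfl⟩ := Nat.not_even_iff_odd.mp he; omega
      rw [ZMod.χ₄_nat_three_mod_four hm] at hneg
      rw [hκ3 hm]
      rcases lt_or_gt_of_ne hpne with h' | h'
      · rw [Int.sign_eq_neg_one_of_neg h', abs_of_neg h', hneg]
        have : -(Real.pi * Complex.I / 4) * ((1 - (-1) : ℤ) : ℂ) * ((-1 : ℤ) : ℂ) =
          Real.pi / 2 * Complex.I := by push_cast; ring
        rw [this, Complex.exp_pi_div_two_mul_I]
        push_cast
        linear_combination (legendreSym (2 * h + 1) p : ℂ) * Complex.I_sq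
      · rw [Int.sign_eq_one_of_pos h', abs_of_pos h']
        have : -(Real.pi * Complex.I / 4) * ((1 - (-1) : ℤ) : ℂ) * ((1 : ℤ) : ℂ) =
          -Real.pi / 2 * Complex.I := by push_cast; ring
        rw [this, Complex.exp_neg_pi_div_two_mul_I]
        linear_combination -(legendreSym (2 * h + 1) p : ℂ) * Complex.I_sq
  rw [hX, ← hkey]
  field_simp
end

section
/- Let K be an odd prime, ζ = exp(2πi/K), and let p ∈ ℤ with p not divisible by K and m ∈ ℕ. Let 4* ∈ ℤ satisfy 4·4* ≡ 1 (mod K), and let κ = 1 if K ≡ 1 (mod 4), κ = −1 if K ≡ 3 (mod 4). Define Y = (ζ−1)^{−1} · K^{−1/2} · e^{−(iπ/4)(1−κ)·sign(p)} · Σ_{0<β<K, β odd} ζ^{4*·p·β²} · ( e^{iπβ/K} − e^{−iπβ/K} )^{2m+2}. Then Y ∈ (ζ−1)^{m}·ℤ[ζ]; that is, there exists x ∈ ℤ[ζ] with Y = (ζ−1)^{m}·x. In particular Y ∈ ℤ[ζ]. -/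
open Finset

lemma aux_coeff (a n k : ℕ) (hk : k < n) :
    ∑ j ∈ range (2 * n + 1), ((-1 : ℤ) ^ (2 * n - j) * ((2 * n).choose j : ℤ)) *
      (((a * ((j : ℤ) - n).natAbs ^ 2).choose k : ℕ) : ℤ) = 0 := by
  have hP : ((descPochhammer ℚ k).comp (Polynomial.C (a : ℚ) *
      (Polynomial.X - Polynomial.C (n : ℚ)) ^ 2)).natDegree < 2 * n := by
    refine lt_of_le_of_lt Polynomial.natDegree_comp_le ?_
    rw [descPochhammer_natDegree]
    have : (Polynomial.C (a : ℚ) * (Polynomial.X - Polynomial.C (n : ℚ)) ^ 2).natDegree ≤ 2 := by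
      refine (Polynomial.natDegree_C_mul_le _ _).trans ?_
      refine (Polynomial.natDegree_pow_le).trans ?_
      rw [Polynomial.natDegree_X_sub_C]
    nlinarith
  have h := congrFun (Polynomial.fwdDiff_iter_eq_zero_of_degree_lt hP) 0
  rw [fwdDiff_iter_eq_sum_shift] at h
  have hf : (k.factorial : ℚ) ≠ 0 := by positivity
  have : ((∑ j ∈ range (2 * n + 1), ((-1 : ℤ) ^ (2 * n - j) * ((2 * n).choose j : ℤ)) *
      (((a * ((j : ℤ) - n).natAbs ^ 2).choose k : ℕ) : ℤ) : ℤ) : ℚ) = 0 := by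
    rw [← mul_right_inj' (inv_ne_zero (inv_ne_zero hf)), mul_zero]
    refine Eq.trans ?_ h
    push_cast
    rw [mul_sum]
    refine sum_congr rfl fun j _ => ?_
    rw [Nat.cast_choose_eq_descPochhammer_div ℚ (a * ((j : ℤ) - n).natAbs ^ 2) k]
    have e : (((a * ((j : ℤ) - n).natAbs ^ 2 : ℕ)) : ℚ) = a * ((j : ℚ) - n) ^ 2 := by
      have : ((((j : ℤ) - n).natAbs ^ 2 : ℕ) : ℤ) = ((j : ℤ) - n) ^ 2 := by
        push_cast; exact sq_abs _
      rw [Nat.cast_mul, ← Int.cast_natCast (((j : ℤ) - n).natAbs ^ 2), this]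
      push_cast; ring
    rw [e]
    simp only [Polynomial.eval_comp, Polynomial.eval_mul, Polynomial.eval_C, Polynomial.eval_pow,
      Polynomial.eval_sub, Polynomial.eval_X, zsmul_eq_mul]
    simp
    field_simp
  exact_mod_cast this

lemma aux_T (a n : ℕ) (ζ : ℂ) : ∃ t ∈ Subring.closure {ζ},
    ∑ j ∈ range (2 * n + 1), ((-1 : ℂ) ^ (2 * n - j) * ((2 * n).choose j : ℂ)) *
      ζ ^ (a * ((j : ℤ) - n).natAbs ^ 2) = (ζ - 1) ^ n * t := by
  let Q : Polynomial ℤ := ∑ j ∈ range (2 * n + 1),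
    Polynomial.C ((-1 : ℤ) ^ (2 * n - j) * ((2 * n).choose j : ℤ)) *
      (1 + Polynomial.X) ^ (a * ((j : ℤ) - n).natAbs ^ 2)
  have hQ : Polynomial.X ^ n ∣ Q := by
    rw [Polynomial.X_pow_dvd_iff]
    intro k hk
    rw [← aux_coeff a n k hk]
    simp only [Q, Polynomial.finsetSum_coeff, Polynomial.coeff_C_mul,
      Polynomial.coeff_one_add_X_pow]
  obtain ⟨q, hq⟩ := hQ
  refine ⟨Polynomial.aeval (ζ - 1) q, ?_, ?_⟩
  · rw [Polynomial.aeval_eq_sum_range]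
    refine Subring.sum_mem _ fun i _ => Subring.zsmul_mem _ (Subring.pow_mem _ ?_ _) _
    exact Subring.sub_mem _ (Subring.subset_closure rfl) (Subring.one_mem _)
  · have := congrArg (Polynomial.aeval (ζ - 1)) hq
    simp only [Q, map_sum, map_mul, map_pow, Polynomial.aeval_X] at this
    rw [← this]
    refine sum_congr rfl fun j _ => ?_
    simp

lemma aux_gauss (K : ℕ) [Fact K.Prime] (hK : K ≠ 2) (ψ : AddChar (ZMod K) ℂ)
    (hψ : ψ.IsPrimitive) :
    (∑ x : ZMod K, ψ (x ^ 2)) ^ 2 = ((ZMod.χ₄ (K : ZMod 4) : ℤ) : ℂ) * K := by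
  have hF : ringChar (ZMod K) ≠ 2 := by rwa [ZMod.ringChar_zmod_n]
  let χ := (quadraticChar (ZMod K)).ringHomComp (Int.castRingHom ℂ)
  have hχ : χ ≠ 1 := by
    intro h
    obtain ⟨a, ha⟩ := quadraticChar_exists_neg_one' hF
    have := congrArg (fun c : MulChar (ZMod K) ℂ => c a) h
    simp [χ, MulChar.ringHomComp_apply, ha] at this
    norm_num at this
  have hχ2 : χ.IsQuadratic := (quadraticChar_isQuadratic (ZMod K)).comp _
  have hs := gaussSum_sq hχ hχ2 hψ
  have h1 : ∑ x : ZMod K, ψ (x ^ 2) = gaussSum χ ψ := by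
    have h0 : ∑ y : ZMod K, ψ y = 0 := by
      refine AddChar.sum_eq_zero_of_ne_one ?_
      have := hψ (one_ne_zero)
      simpa using this
    have : ∑ x : ZMod K, ψ (x ^ 2) = ∑ y : ZMod K, (χ y + 1) * ψ y := by
      rw [← Finset.sum_fiberwise (univ : Finset (ZMod K)) (fun x => x ^ 2)]
      refine sum_congr rfl fun y _ => ?_
      have hc := quadraticChar_card_sqrts hF y
      rw [sum_congr rfl (g := fun _ => ψ y) (by intro x hx; simp at hx; rw [hx])]
      rw [sum_const, nsmul_eq_mul]
      congr 1
      have : ((#{x : ZMod K | x ^ 2 = y} : ℤ) : ℂ) = ((quadraticChar (ZMod K) y + 1 : ℤ) : ℂ) := by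
        rw [← hc]
        congr 3
        ext; simp
      simpa [χ, MulChar.ringHomComp_apply] using this
    rw [this, gaussSum]
    simp only [add_mul, one_mul, sum_add_distrib, h0, add_zero]
  rw [h1, hs]
  simp [χ, MulChar.ringHomComp_apply, quadraticChar_neg_one hF, ZMod.card]

lemma aux_sq (K : ℕ) [Fact K.Prime] (ψ : AddChar (ZMod K) ℂ) (q r d : ZMod K)
    (h : 4 * q * r = 1) :
    ∑ x, ψ (q * x ^ 2 + d * x) = ψ (-r * d ^ 2) * ∑ x, ψ (q * x ^ 2) := by
  rw [mul_sum]
  refine Fintype.sum_equiv (Equiv.addRight (2 * d * r)) _ _ fun x => ?_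
  rw [← AddChar.map_add_eq_mul]
  congr 1
  simp only [Equiv.coe_addRight]
  linear_combination (-d * x - d ^ 2 * r) * h

lemma aux_F (K : ℕ) [Fact K.Prime] (ψ : AddChar (ZMod K) ℂ) (q r : ZMod K)
    (h : 4 * q * r = 1) (n : ℕ) :
    ∑ x, ψ (q * x ^ 2) * (ψ x + ψ (-x) - 2) ^ n = (∑ x, ψ (q * x ^ 2)) *
    ∑ j ∈ range (2 * n + 1), ((-1 : ℂ) ^ (2 * n - j) * ((2 * n).choose j : ℂ)) *
      ψ 1 ^ ((-r).val * ((j : ℤ) - n).natAbs ^ 2) := by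
  have hx : ∀ x : ZMod K, ψ (q * x ^ 2) * (ψ x + ψ (-x) - 2) ^ n =
      ∑ j ∈ range (2 * n + 1), ((-1 : ℂ) ^ (2 * n - j) * ((2 * n).choose j : ℂ)) *
        ψ (q * x ^ 2 + (((j : ℤ) - n : ℤ) : ZMod K) * x) := by
    intro x
    have e0 : ψ (-x) * ψ x = 1 := by
      rw [← AddChar.map_add_eq_mul]; simp
    have e1 : (ψ x + ψ (-x) - 2) = ψ (-x) * (ψ x + (-1)) ^ 2 := by
      linear_combination (2 - ψ x) * e0
    rw [e1, mul_pow, ← pow_mul, add_pow, mul_sum, mul_sum]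
    refine sum_congr rfl fun j _ => ?_
    have e2 : ψ (q * x ^ 2 + (((j : ℤ) - n : ℤ) : ZMod K) * x) =
        ψ (q * x ^ 2) * (ψ (-x) ^ n * ψ x ^ j) := by
      rw [← AddChar.map_nsmul_eq_pow, ← AddChar.map_nsmul_eq_pow, ← AddChar.map_add_eq_mul,
        ← AddChar.map_add_eq_mul]
      congr 1
      simp only [nsmul_eq_mul]
      push_cast
      ring
    rw [e2]; ring
  simp_rw [hx]
  rw [sum_comm, mul_sum]
  refine sum_congr rfl fun j _ => ?_
  rw [← mul_sum, aux_sq K ψ q r _ h, ← AddChar.map_nsmul_eq_pow]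
  have : ((-r).val * ((j : ℤ) - n).natAbs ^ 2) • (1 : ZMod K) =
      -r * (((j : ℤ) - n : ℤ) : ZMod K) ^ 2 := by
    rw [nsmul_eq_mul, mul_one, Nat.cast_mul, ZMod.natCast_zmod_val]
    congr 1
    have : ((((j : ℤ) - n).natAbs ^ 2 : ℕ) : ℤ) = ((j : ℤ) - n) ^ 2 := by
      push_cast; exact sq_abs _
    rw [← Int.cast_natCast (((j : ℤ) - n).natAbs ^ 2), this]
    push_cast; ring
  rw [this]
  ring

lemma aux_half (K : ℕ) [Fact K.Prime] (hKodd : Odd K) (F : ZMod K → ℂ) (h0 : F 0 = 0)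
    (he : ∀ x, F (-x) = F x) :
    2 * ∑ β ∈ (Finset.Ioo (0 : ℤ) (K : ℤ)).filter (fun β => Odd β), F (β : ZMod K)
      = ∑ x, F x := by
  have h1 : ∑ β ∈ (Finset.Ioo (0 : ℤ) (K : ℤ)).filter (fun β => ¬ Odd β), F (β : ZMod K) =
      ∑ β ∈ (Finset.Ioo (0 : ℤ) (K : ℤ)).filter (fun β => Odd β), F (β : ZMod K) := by
    have hK' : Odd (K : ℤ) := by exact_mod_cast hKodd
    refine sum_bij' (fun β _ => (K : ℤ) - β) (fun β _ => (K : ℤ) - β) ?_ ?_ ?_ ?_ ?_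
    · intro β hb
      simp only [mem_filter, mem_Ioo] at hb ⊢
      refine ⟨by omega, ?_⟩
      rw [Int.odd_iff] at *; omega
    · intro β hb
      simp only [mem_filter, mem_Ioo] at hb ⊢
      refine ⟨by omega, ?_⟩
      rw [Int.odd_iff] at *; omega
    · intros; ring
    · intros; ring
    · intro β _
      push_cast
      simp [he]
  have h2 := sum_filter_add_sum_filter_not (Finset.Ioo (0 : ℤ) (K : ℤ)) (fun β => Odd β)
    (fun β => F (β : ZMod K))
  rw [h1] at h2
  rw [two_mul, h2]
  rw [← sum_erase (univ : Finset (ZMod K)) h0]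
  refine sum_bij' (fun β _ => (β : ZMod K)) (fun x _ => (x.val : ℤ)) ?_ ?_ ?_ ?_ ?_
  · intro β hb
    simp only [mem_Ioo] at hb
    simp only [mem_erase, mem_univ, and_true]
    rw [Ne, ZMod.intCast_zmod_eq_zero_iff_dvd]
    intro hd
    have := Int.le_of_dvd hb.1 hd
    omega
  · intro x hx
    simp only [mem_erase, mem_univ, and_true] at hx
    simp only [mem_Ioo]
    have := ZMod.val_lt x
    have := (ZMod.val_pos (a := x)).2 hx
    omega
  · intro β hb
    simp only [mem_Ioo] at hb
    rw [ZMod.val_intCast, Int.emod_eq_of_lt hb.1.le hb.2]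
  · intro x _; simp
  · intros; rfl

theorem stmt7 (K : ℕ) (hK : K.Prime) (hKodd : Odd K)
    (ζ : ℂ) (hζ : ζ = Complex.exp (2 * Real.pi * Complex.I / K))
    (p : ℤ) (hp : ¬ (K : ℤ) ∣ p) (m : ℕ)
    (fourstar : ℤ) (h4 : 4 * fourstar ≡ 1 [ZMOD (K : ℤ)])
    (κ : ℤ) (hκ1 : K % 4 = 1 → κ = 1) (hκ3 : K % 4 = 3 → κ = -1)
    (Y : ℂ)
    (hY : Y = (ζ - 1)⁻¹ * (Real.sqrt K : ℂ)⁻¹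
        * Complex.exp (-(Real.pi * Complex.I / 4) * ((1 - κ : ℤ) : ℂ) * (p.sign : ℂ))
        * ∑ β ∈ (Finset.Ioo (0 : ℤ) (K : ℤ)).filter (fun β => Odd β),
            ζ ^ (fourstar * p * β ^ 2)
              * (Complex.exp (Real.pi * Complex.I * (β : ℂ) / K)
                - Complex.exp (-(Real.pi * Complex.I * (β : ℂ) / K))) ^ (2 * m + 2)) :
    ∃ x ∈ Subring.closure {ζ}, Y = (ζ - 1) ^ m * x := by
  have : Fact K.Prime := ⟨hK⟩
  have hK2 : K ≠ 2 := by rintro rfl; exact absurd hKodd (by decide)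
  have hK0 : (K : ℂ) ≠ 0 := by exact_mod_cast hK.ne_zero
  let ψ : AddChar (ZMod K) ℂ := ZMod.stdAddChar
  have hψp : ψ.IsPrimitive := ZMod.isPrimitive_stdAddChar K
  have hψz : ∀ j : ℤ, ψ (j : ZMod K) = ζ ^ j := by
    intro j
    rw [hζ, ← Complex.exp_int_mul, show ψ (j : ZMod K) = _ from ZMod.stdAddChar_coe j]
    congr 1; ring
  have hψ1 : ψ 1 = ζ := by simpa using hψz 1
  set R := Subring.closure {ζ} with hR
  have hζR : ζ ∈ R := Subring.subset_closure rfl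
  have hψR : ∀ x, ψ x ∈ R := by
    intro x
    have : ψ x = ζ ^ x.val := by
      have := hψz (x.val : ℤ)
      rwa [Int.cast_natCast, ZMod.natCast_zmod_val, zpow_natCast] at this
    rw [this]; exact R.pow_mem hζR _
  have hprim : IsPrimitiveRoot ζ K := by rw [hζ]; exact Complex.isPrimitiveRoot_exp K hK.ne_zero
  have hh : ζ - 1 ≠ 0 := sub_ne_zero.2 (hprim.ne_one hK.one_lt)
  -- K = h * k
  obtain ⟨k, hkR, hk⟩ : ∃ k ∈ R, (K : ℂ) = (ζ - 1) * k := by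
    refine ⟨-∑ i ∈ range K, ∑ l ∈ range i, ζ ^ l,
      R.neg_mem (R.sum_mem fun i _ => R.sum_mem fun l _ => R.pow_mem hζR _), ?_⟩
    have h0 := hprim.geom_sum_eq_zero hK.one_lt
    rw [mul_neg, mul_sum]
    simp_rw [mul_geom_sum]
    rw [sum_sub_distrib, h0]
    simp
  set q : ZMod K := ((fourstar * p : ℤ) : ZMod K) with hq
  have hp0 : (p : ZMod K) ≠ 0 := by rwa [Ne, ZMod.intCast_zmod_eq_zero_iff_dvd]
  have h4' : (4 : ZMod K) * fourstar = 1 := by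
    have := (ZMod.intCast_eq_intCast_iff _ _ _).2 h4
    exact_mod_cast this
  have hqr : 4 * q * (p : ZMod K)⁻¹ = 1 := by
    rw [hq]; push_cast
    rw [← mul_assoc, h4', one_mul, mul_inv_cancel₀ hp0]
  have hq0 : q ≠ 0 := by rintro h; simp [h] at hqr
  set g : ℂ := ∑ x : ZMod K, ψ (q * x ^ 2) with hg
  have hκ : ZMod.χ₄ (K : ZMod 4) = κ ∧ κ ^ 2 = 1 := by
    have : K % 4 = 1 ∨ K % 4 = 3 := by
      rw [Nat.odd_iff] at hKodd; omega
    rcases this with h | h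
    · rw [ZMod.χ₄_nat_one_mod_four h, hκ1 h]; simp
    · rw [ZMod.χ₄_nat_three_mod_four h, hκ3 h]; simp
  have hgsq : g ^ 2 = (κ : ℂ) * K := by
    have := aux_gauss K hK2 (ψ.mulShift q) (by
      intro b hb
      rw [AddChar.mulShift_mulShift]
      exact hψp (mul_ne_zero hq0 hb))
    rw [hκ.1] at this
    simpa [AddChar.mulShift_apply] using this
  have hκ0 : (κ : ℂ) ≠ 0 := by
    intro h
    have : κ = 0 := by exact_mod_cast h
    simp [this] at hκ
  have hg0 : g ≠ 0 := by
    intro h; rw [h] at hgsq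
    exact mul_ne_zero hκ0 hK0 (by rw [← hgsq]; simp)
  -- prefactor
  set c : ℂ := (Real.sqrt K : ℂ)⁻¹
        * Complex.exp (-(Real.pi * Complex.I / 4) * ((1 - κ : ℤ) : ℂ) * (p.sign : ℂ)) with hc
  have hcsq : c ^ 2 = κ / K := by
    have hs : ((Real.sqrt K : ℂ)) ^ 2 = K := by
      rw [← Complex.ofReal_pow, Real.sq_sqrt (Nat.cast_nonneg K)]; simp
    have he : Complex.exp (-(Real.pi * Complex.I / 4) * ((1 - κ : ℤ) : ℂ) * (p.sign : ℂ)) ^ 2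
        = κ := by
      rw [← Complex.exp_nat_mul]
      have hp1 : p ≠ 0 := by rintro rfl; simp at hp
      have hκc : κ = 1 ∨ κ = -1 := (sq_eq_sq_iff_eq_or_eq_neg.1 (by rw [hκ.2]; norm_num))
      rcases hκc with h | h
      · rw [h]; simp
      · rw [h]
        rcases lt_or_gt_of_ne hp1 with h' | h'
        · rw [Int.sign_eq_neg_one_of_neg h']
          have : ((2 : ℕ) : ℂ) * (-(Real.pi * Complex.I / 4) * ((1 - (-1) : ℤ) : ℂ) *
            ((-1 : ℤ) : ℂ)) = Real.pi * Complex.I := by push_cast; ring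
          rw [this, Complex.exp_pi_mul_I]; simp
        · rw [Int.sign_eq_one_of_pos h']
          have : ((2 : ℕ) : ℂ) * (-(Real.pi * Complex.I / 4) * ((1 - (-1) : ℤ) : ℂ) *
            ((1 : ℤ) : ℂ)) = -(Real.pi * Complex.I) := by push_cast; ring
          rw [this, Complex.exp_neg, Complex.exp_pi_mul_I]; norm_num
    rw [hc, mul_pow, inv_pow, hs, he]; field_simp
  have hcg : c * g = 1 ∨ c * g = -1 := by
    rw [← sq_eq_sq_iff_eq_or_eq_neg, one_pow, mul_pow, hcsq, hgsq]
    have : (κ : ℂ) ^ 2 = 1 := by exact_mod_cast hκ.2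
    field_simp
    exact this
  -- the sum
  set S : ℂ := ∑ β ∈ (Finset.Ioo (0 : ℤ) (K : ℤ)).filter (fun β => Odd β),
            ζ ^ (fourstar * p * β ^ 2)
              * (Complex.exp (Real.pi * Complex.I * (β : ℂ) / K)
                - Complex.exp (-(Real.pi * Complex.I * (β : ℂ) / K))) ^ (2 * m + 2) with hS
  let F : ZMod K → ℂ := fun x => ψ (q * x ^ 2) * (ψ x + ψ (-x) - 2) ^ (m + 1)
  have hSF : S = ∑ β ∈ (Finset.Ioo (0 : ℤ) (K : ℤ)).filter (fun β => Odd β),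
      F (β : ZMod K) := by
    rw [hS]
    refine sum_congr rfl fun β _ => ?_
    have e1 : ψ (q * (β : ZMod K) ^ 2) = ζ ^ (fourstar * p * β ^ 2) := by
      rw [← hψz, hq]; push_cast; rfl
    have e2 : ψ (β : ZMod K) = Complex.exp (Real.pi * Complex.I * (β : ℂ) / K) ^ 2 := by
      rw [hψz, hζ, ← Complex.exp_int_mul, ← Complex.exp_nat_mul]
      congr 1; push_cast; ring
    have e3 : ψ (-(β : ZMod K)) = Complex.exp (-(Real.pi * Complex.I * (β : ℂ) / K)) ^ 2 := by
      rw [← Int.cast_neg, hψz, hζ, ← Complex.exp_int_mul, ← Complex.exp_nat_mul]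
      congr 1; push_cast; ring
    have e4 : Complex.exp (Real.pi * Complex.I * (β : ℂ) / K) *
        Complex.exp (-(Real.pi * Complex.I * (β : ℂ) / K)) = 1 := by
      rw [← Complex.exp_add]; simp
    simp only [F]
    rw [e1, e2, e3, show 2 * m + 2 = 2 * (m + 1) by ring, pow_mul]
    congr 2
    linear_combination (-2) * e4
  have hSR : S ∈ R := by
    rw [hSF]
    refine R.sum_mem fun β _ => R.mul_mem (hψR _) (R.pow_mem (R.sub_mem (R.add_mem (hψR _) (hψR _))
      ?_) _)
    exact_mod_cast natCast_mem R 2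
  obtain ⟨t, htR, ht⟩ := aux_T (-(p : ZMod K)⁻¹).val (m + 1) ζ
  have h2S : 2 * S = g * ((ζ - 1) ^ (m + 1) * t) := by
    rw [hSF, aux_half K hKodd F (by simp [F]; norm_num) (by
      intro x; simp only [F, neg_neg, neg_sq]; rw [add_comm (ψ (-x))])]
    rw [← ht, ← hψ1]
    exact aux_F K ψ q _ hqr (m + 1)
  have hgR : g ∈ R := R.sum_mem fun x _ => hψR _
  -- t / 2 lies in R
  have htR2 : t / 2 ∈ R := by
    obtain ⟨N, hN⟩ : Odd (K ^ (m + 2)) := hKodd.pow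
    have hN' : (K : ℂ) ^ (m + 2) = 2 * N + 1 := by exact_mod_cast hN
    have key : t / 2 = κ * (k ^ (m + 1) * (g * S)) - N * t := by
      have e1 : g * (2 * S) = κ * K * ((ζ - 1) ^ (m + 1) * t) := by
        rw [h2S, ← hgsq]; ring
      have e2 : (κ : ℂ) * κ = 1 := by have := hκ.2; rw [sq] at this; exact_mod_cast this
      have e3 : (K : ℂ) ^ (m + 2) = K * ((ζ - 1) ^ (m + 1) * k ^ (m + 1)) := by
        rw [← mul_pow, ← hk]; ring
      rw [e3] at hN'
      linear_combination (-κ * k ^ (m + 1) / 2) * e1 - (t / 2) * hN'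
        - (K * (ζ - 1) ^ (m + 1) * t * k ^ (m + 1) / 2) * e2
    rw [key]
    exact R.sub_mem (R.mul_mem (intCast_mem R _) (R.mul_mem (R.pow_mem hkR _)
      (R.mul_mem hgR hSR))) (R.mul_mem (natCast_mem R _) htR)
  have hYc : Y = (c * g) * ((ζ - 1) ^ m * (t / 2)) := by
    have : Y = (ζ - 1)⁻¹ * c * S := by rw [hY, hc]; ring
    rw [this]
    have : S = g * ((ζ - 1) ^ (m + 1) * t) / 2 := by rw [← h2S]; ring
    rw [this, pow_succ]
    field_simp
  rcases hcg with h | h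
  · exact ⟨t / 2, htR2, by rw [hYc, h, one_mul]⟩
  · exact ⟨-(t / 2), R.neg_mem htR2, by rw [hYc, h]; ring⟩
end
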